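/- arXiv:2404.18070 — 2 statements merged into one kernel-verified Lean document; each statement's English description precedes it below -/
import Mathlib

section
/- Let n ≥ 3 be an integer and λ > 0. Then the Wronskian of G and D is constant: G(z)·D'(z) − G'(z)·D(z) = −n/2 for all z > 0. -/
/-- The modified Bessel function of the second kind,
`K_ν(y) = ∫_0^∞ e^{-y·cosh t} · cosh(ν t) dt`. -/
noncomputable def besselK (ν y : ℝ) : ℝ :=
  ∫ t in Set.Ioi (0:ℝ), Real.exp (-y * Real.cosh t) * Real.cosh (ν * t)

/-- The modified Bessel function of the first kind,
`I_ν(y) = (1/π)∫_0^π e^{y·cos θ}·cos(νθ) dθ − (sin(νπ)/π)∫_0^∞ e^{-y·cosh t − νt} dt`. -/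
noncomputable def besselI (ν y : ℝ) : ℝ :=
  (1 / Real.pi) * ∫ θ in (0:ℝ)..Real.pi, Real.exp (y * Real.cos θ) * Real.cos (ν * θ)
    - (Real.sin (ν * Real.pi) / Real.pi) *
      ∫ t in Set.Ioi (0:ℝ), Real.exp (-y * Real.cosh t - ν * t)

/-- The decaying solution `D(z) = √z · K_{1/n}(2·√(λ/n)·z^{n/2})`. -/
noncomputable def calD (n : ℕ) (lam z : ℝ) : ℝ :=
  Real.sqrt z * besselK (1 / (n : ℝ)) (2 * Real.sqrt (lam / n) * z ^ ((n : ℝ) / 2))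

/-- The growing solution `G(z) = √z · I_{1/n}(2·√(λ/n)·z^{n/2})`. -/
noncomputable def calG (n : ℕ) (lam z : ℝ) : ℝ :=
  Real.sqrt z * besselI (1 / (n : ℝ)) (2 * Real.sqrt (lam / n) * z ^ ((n : ℝ) / 2))

open MeasureTheory Filter Topology Set

/-- The integral `∫_0^∞ e^{-y·cosh t + ν t} dt`. -/
noncomputable def expCoshIntegral (ν y : ℝ) : ℝ :=
  ∫ t in Ioi (0:ℝ), Real.exp (-y * Real.cosh t + ν * t)

/-- The integral `∫_0^π e^{y·cos θ}·cos(νθ) dθ`. -/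
noncomputable def expCosIntegral (ν y : ℝ) : ℝ :=
  ∫ θ in (0:ℝ)..Real.pi, Real.exp (y * Real.cos θ) * Real.cos (ν * θ)

lemma one_add_sq_div_two_le_cosh (t : ℝ) : 1 + t ^ 2 / 2 ≤ Real.cosh t := by
  have h : ∀ u : ℝ, 0 ≤ u → 1 + u ^ 2 / 2 ≤ Real.cosh u := fun u hu ↦ by
    have h₁ : u / 2 ≤ Real.sinh (u / 2) := Real.self_le_sinh_iff.2 (by positivity)
    have h₂ := Real.cosh_two_mul (u / 2)
    rw [Real.cosh_sq, mul_div_cancel₀ u two_ne_zero] at h₂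
    nlinarith
  simpa using h |t| (abs_nonneg t)

lemma integrable_exp_neg_mul_sq_add_mul {b : ℝ} (hb : 0 < b) (a : ℝ) :
    Integrable fun t : ℝ ↦ Real.exp (-b * t ^ 2 + a * t) := by
  refine ((integrable_exp_neg_mul_sq (half_pos hb)).const_mul
    (Real.exp (a ^ 2 / (2 * b)))).mono' (by fun_prop) (ae_of_all _ fun t ↦ ?_)
  rw [Real.norm_eq_abs, Real.abs_exp, ← Real.exp_add, Real.exp_le_exp]
  have h : a ^ 2 / (2 * b) + -(b / 2) * t ^ 2 - (-b * t ^ 2 + a * t)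
      = (b * t - a) ^ 2 / (2 * b) := by
    field_simp
    ring
  have : 0 ≤ (b * t - a) ^ 2 / (2 * b) := by positivity
  linarith

lemma integrable_exp_neg_mul_cosh_add_mul {y : ℝ} (hy : 0 < y) (ν : ℝ) :
    Integrable fun t : ℝ ↦ Real.exp (-y * Real.cosh t + ν * t) := by
  refine (integrable_exp_neg_mul_sq_add_mul (half_pos hy) ν).mono' (by fun_prop)
    (ae_of_all _ fun t ↦ ?_)
  rw [Real.norm_eq_abs, Real.abs_exp, Real.exp_le_exp]
  nlinarith [one_add_sq_div_two_le_cosh t]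

lemma cosh_mul_exp_neg_mul_cosh (y ν t : ℝ) :
    Real.cosh t * Real.exp (-y * Real.cosh t + ν * t) =
      (Real.exp (-y * Real.cosh t + (ν + 1) * t)
        + Real.exp (-y * Real.cosh t + (ν - 1) * t)) / 2 := by
  rw [show -y * Real.cosh t + (ν + 1) * t = -y * Real.cosh t + ν * t + t by ring,
    show -y * Real.cosh t + (ν - 1) * t = -y * Real.cosh t + ν * t + -t by ring,
    Real.exp_add _ t, Real.exp_add _ (-t), Real.cosh_eq t]
  ring

lemma sinh_mul_exp_neg_mul_cosh (y ν t : ℝ) :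
    Real.sinh t * Real.exp (-y * Real.cosh t + ν * t) =
      (Real.exp (-y * Real.cosh t + (ν + 1) * t)
        - Real.exp (-y * Real.cosh t + (ν - 1) * t)) / 2 := by
  rw [show -y * Real.cosh t + (ν + 1) * t = -y * Real.cosh t + ν * t + t by ring,
    show -y * Real.cosh t + (ν - 1) * t = -y * Real.cosh t + ν * t + -t by ring,
    Real.exp_add _ t, Real.exp_add _ (-t), Real.sinh_eq t]
  ring

lemma hasDerivAt_expCoshIntegral (ν : ℝ) {y : ℝ} (hy : 0 < y) :
    HasDerivAt (expCoshIntegral ν)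
      (-(expCoshIntegral (ν + 1) y + expCoshIntegral (ν - 1) y) / 2) y := by
  have hcosh (x : ℝ) (hx : 0 < x) :
      Integrable fun t : ℝ ↦ Real.cosh t * Real.exp (-x * Real.cosh t + ν * t) := by
    simp_rw [cosh_mul_exp_neg_mul_cosh]
    exact ((integrable_exp_neg_mul_cosh_add_mul hx _).add
      (integrable_exp_neg_mul_cosh_add_mul hx _)).div_const 2
  have h := (hasDerivAt_integral_of_dominated_loc_of_deriv_le (μ := volume.restrict (Ioi (0:ℝ)))
    (F := fun x t ↦ Real.exp (-x * Real.cosh t + ν * t))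
    (F' := fun x t ↦ -(Real.cosh t * Real.exp (-x * Real.cosh t + ν * t)))
    (bound := fun t ↦ Real.cosh t * Real.exp (-(y / 2) * Real.cosh t + ν * t))
    (Ioi_mem_nhds (half_lt_self hy)) (Eventually.of_forall fun x ↦ by fun_prop)
    (integrable_exp_neg_mul_cosh_add_mul hy ν).integrableOn (by fun_prop)
    (ae_of_all _ fun t x hx ↦ by
      have hc := Real.cosh_pos t
      rw [norm_neg, Real.norm_eq_abs, abs_of_pos (by positivity)]
      have : y / 2 ≤ x := le_of_lt hx
      gcongr)
    (hcosh _ (half_pos hy)).integrableOn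
    (ae_of_all _ fun t x _ ↦ by
      have h := (((hasDerivAt_id x).neg.mul_const (Real.cosh t)).add_const (ν * t)).exp
      refine h.congr_deriv ?_
      simp only [Pi.neg_apply, id]
      ring)).2
  refine HasDerivAt.congr_deriv (f := expCoshIntegral ν) h ?_
  rw [integral_neg]
  simp_rw [cosh_mul_exp_neg_mul_cosh]
  rw [integral_div, integral_add (integrable_exp_neg_mul_cosh_add_mul hy _).integrableOn
    (integrable_exp_neg_mul_cosh_add_mul hy _).integrableOn, neg_div]
  rfl

lemma expCoshIntegral_recurrence (ν : ℝ) {y : ℝ} (hy : 0 < y) :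
    y * (expCoshIntegral (ν + 1) y - expCoshIntegral (ν - 1) y) / 2
      = ν * expCoshIntegral ν y + Real.exp (-y) := by
  have hi (μ : ℝ) : IntegrableOn (fun t ↦ Real.exp (-y * Real.cosh t + μ * t)) (Ioi (0:ℝ)) :=
    (integrable_exp_neg_mul_cosh_add_mul hy μ).integrableOn
  have hd (t : ℝ) : HasDerivAt (fun t ↦ Real.exp (-y * Real.cosh t + ν * t))
      (ν * Real.exp (-y * Real.cosh t + ν * t)
        - y * ((Real.exp (-y * Real.cosh t + (ν + 1) * t)
          - Real.exp (-y * Real.cosh t + (ν - 1) * t)) / 2)) t := by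
    rw [← sinh_mul_exp_neg_mul_cosh]
    refine (((Real.hasDerivAt_cosh t).const_mul (-y)).add
      ((hasDerivAt_id t).const_mul ν)).exp.congr_deriv ?_
    simp only [id, Pi.add_apply]
    ring
  have hs : IntegrableOn (fun t ↦ y * ((Real.exp (-y * Real.cosh t + (ν + 1) * t)
      - Real.exp (-y * Real.cosh t + (ν - 1) * t)) / 2)) (Ioi (0:ℝ)) :=
    (((hi (ν + 1)).sub (hi (ν - 1))).div_const 2).const_mul y
  have hi' := ((hi ν).const_mul ν).sub hs
  have h := integral_Ioi_of_hasDerivAt_of_tendsto' (fun t _ ↦ hd t) hi'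
    (tendsto_zero_of_hasDerivAt_of_integrableOn_Ioi (fun t _ ↦ hd t) hi' (hi ν))
  rw [integral_sub ((hi ν).const_mul ν) hs, integral_const_mul, integral_const_mul,
    integral_div, integral_sub (hi _) (hi _)] at h
  simp only [Real.cosh_zero, mul_zero, mul_one, add_zero] at h
  simp only [expCoshIntegral]
  linarith

lemma hasDerivAt_expCosIntegral (ν y : ℝ) :
    HasDerivAt (expCosIntegral ν)
      ((expCosIntegral (ν + 1) y + expCosIntegral (ν - 1) y) / 2) y := by
  have h := (intervalIntegral.hasDerivAt_integral_of_dominated_loc_of_deriv_le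
    (μ := volume) (a := 0) (b := Real.pi)
    (F := fun x θ ↦ Real.exp (x * Real.cos θ) * Real.cos (ν * θ))
    (F' := fun x θ ↦ Real.exp (x * Real.cos θ) * Real.cos θ * Real.cos (ν * θ))
    (x₀ := y) (bound := fun _ ↦ Real.exp (|y| + 1))
    (Metric.ball_mem_nhds y one_pos)
    (Eventually.of_forall fun x ↦ (by fun_prop : Continuous _).aestronglyMeasurable)
    ((by fun_prop : Continuous _).intervalIntegrable _ _)
    ((by fun_prop : Continuous _).aestronglyMeasurable)
    (ae_of_all _ fun θ _ x hx ↦ by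
      have hx' : |x| ≤ |y| + 1 := by
        have := abs_sub_abs_le_abs_sub x y
        rw [Metric.mem_ball, Real.dist_eq] at hx
        linarith
      have h₁ : x * Real.cos θ ≤ |y| + 1 := calc
        x * Real.cos θ ≤ |x| * |Real.cos θ| := by rw [← abs_mul]; exact le_abs_self _
        _ ≤ |x| * 1 := by gcongr; exact Real.abs_cos_le_one θ
        _ ≤ |y| + 1 := by linarith
      rw [norm_mul, norm_mul, Real.norm_eq_abs, Real.norm_eq_abs, Real.norm_eq_abs, Real.abs_exp]
      calc Real.exp (x * Real.cos θ) * |Real.cos θ| * |Real.cos (ν * θ)|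
          ≤ Real.exp (|y| + 1) * 1 * 1 := by
            gcongr
            · exact Real.abs_cos_le_one _
            · exact Real.abs_cos_le_one _
        _ = _ := by ring)
    (by simp)
    (ae_of_all _ fun θ _ x _ ↦ by
      simpa using (((hasDerivAt_id x).mul_const (Real.cos θ)).exp.mul_const (Real.cos (ν * θ))))).2
  refine HasDerivAt.congr_deriv (f := expCosIntegral ν) h ?_
  simp only [expCosIntegral]
  rw [← intervalIntegral.integral_add
    ((by fun_prop : Continuous _).intervalIntegrable _ _)
    ((by fun_prop : Continuous _).intervalIntegrable _ _), ← intervalIntegral.integral_div]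
  refine intervalIntegral.integral_congr fun θ _ ↦ ?_
  simp only [add_mul, sub_mul, one_mul, Real.cos_add, Real.cos_sub]
  ring

lemma expCosIntegral_recurrence (ν y : ℝ) :
    y * (expCosIntegral (ν + 1) y - expCosIntegral (ν - 1) y) / 2
      = Real.exp (-y) * Real.sin (ν * Real.pi) - ν * expCosIntegral ν y := by
  have hi (μ : ℝ) : IntervalIntegrable (fun θ ↦ Real.exp (y * Real.cos θ) * Real.cos (μ * θ))
      volume 0 Real.pi := (by fun_prop : Continuous _).intervalIntegrable _ _
  have hd (θ : ℝ) : HasDerivAt (fun θ ↦ Real.exp (y * Real.cos θ) * Real.sin (ν * θ))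
      (ν * (Real.exp (y * Real.cos θ) * Real.cos (ν * θ))
        + y / 2 * (Real.exp (y * Real.cos θ) * Real.cos ((ν + 1) * θ)
          - Real.exp (y * Real.cos θ) * Real.cos ((ν - 1) * θ))) θ := by
    refine (((Real.hasDerivAt_cos θ).const_mul y).exp.mul
      ((hasDerivAt_id θ).const_mul ν).sin).congr_deriv ?_
    simp only [id, add_mul, sub_mul, one_mul, Real.cos_add, Real.cos_sub]
    ring
  have h := intervalIntegral.integral_eq_sub_of_hasDerivAt (a := 0) (b := Real.pi)
    (fun θ _ ↦ hd θ)
    (((hi ν).const_mul ν).add (((hi (ν + 1)).sub (hi (ν - 1))).const_mul (y / 2)))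
  rw [intervalIntegral.integral_add ((hi ν).const_mul ν)
    (((hi (ν + 1)).sub (hi (ν - 1))).const_mul (y / 2)), intervalIntegral.integral_const_mul,
    intervalIntegral.integral_const_mul, intervalIntegral.integral_sub (hi _) (hi _)] at h
  simp only [Real.cos_pi, mul_neg, mul_one, mul_zero, Real.sin_zero, sub_zero] at h
  simp only [expCosIntegral]
  linarith

lemma tendsto_mul_comp_div_atTop {f : ℝ → ℝ} (hf : HasDerivAt f 1 0) (h0 : f 0 = 0) (a : ℝ) :
    Tendsto (fun r : ℝ ↦ r * f (a / r)) atTop (𝓝 a) := by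
  have h : HasDerivAt (fun x : ℝ ↦ f (a * x)) a 0 := by
    have ha : HasDerivAt (fun x : ℝ ↦ a * x) a 0 := by
      simpa using (hasDerivAt_id (0 : ℝ)).const_mul a
    have hf' : HasDerivAt f 1 (a * 0) := by rwa [mul_zero]
    exact (hf'.comp 0 ha).congr_deriv (one_mul a)
  have h' := h.tendsto_slope_zero.comp
    (tendsto_inv_atTop_nhdsGT_zero.mono_right (nhdsWithin_mono _ fun x hx ↦ ne_of_gt hx))
  refine h'.congr fun r ↦ ?_
  simp [h0, div_eq_mul_inv]

lemma integral_exp_neg_sq_div_two_Ioi :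
    ∫ s in Ioi (0:ℝ), Real.exp (-(s ^ 2 / 2)) = √(2 * Real.pi) / 2 := by
  convert integral_gaussian_Ioi (1 / 2) using 3
  · ring_nf
  · ring_nf

lemma tendsto_expCoshIntegral (ν : ℝ) :
    Tendsto (fun r : ℝ ↦ r * Real.exp (r ^ 2) * expCoshIntegral ν (r ^ 2)) atTop
      (𝓝 (√(2 * Real.pi) / 2)) := by
  rw [← integral_exp_neg_sq_div_two_Ioi]
  have key : Tendsto (fun r : ℝ ↦ ∫ s in Ioi (0:ℝ),
      Real.exp (-(r ^ 2 * (Real.cosh (s / r) - 1)) + ν * (s / r))) atTop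
      (𝓝 (∫ s in Ioi (0:ℝ), Real.exp (-(s ^ 2 / 2)))) := by
    refine tendsto_integral_filter_of_dominated_convergence
      (fun s ↦ Real.exp (-(1 / 2) * s ^ 2 + |ν| * s))
      (Eventually.of_forall fun r ↦ (by fun_prop : Continuous _).aestronglyMeasurable) ?_
      (integrable_exp_neg_mul_sq_add_mul one_half_pos _).integrableOn ?_
    · filter_upwards [eventually_ge_atTop 1] with r hr
      filter_upwards [ae_restrict_mem measurableSet_Ioi] with s hs
      have hr0 : 0 < r := by linarith
      have hs0 : (0:ℝ) < s := hs
      rw [Real.norm_eq_abs, Real.abs_exp, Real.exp_le_exp]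
      have h₁ : s ^ 2 / 2 ≤ r ^ 2 * (Real.cosh (s / r) - 1) := calc
        s ^ 2 / 2 = r ^ 2 * ((s / r) ^ 2 / 2) := by field_simp
        _ ≤ _ := by
          gcongr
          linarith [one_add_sq_div_two_le_cosh (s / r)]
      have h₂ : ν * (s / r) ≤ |ν| * s := by
        gcongr
        · exact le_abs_self ν
        · exact div_le_self hs0.le hr
      linarith
    · refine ae_of_all _ fun s ↦ ?_
      have h₁ := tendsto_mul_comp_div_atTop (by simpa using Real.hasDerivAt_sinh 0)
        Real.sinh_zero (s / 2)
      have h₂ : Tendsto (fun r : ℝ ↦ s / r) atTop (𝓝 0) :=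
        tendsto_const_nhds.div_atTop tendsto_id
      have h₃ := (((h₁.pow 2).const_mul 2).neg.add (h₂.const_mul ν)).rexp
      convert h₃ using 2 with r
      · have hc := Real.cosh_two_mul (s / 2 / r)
        rw [Real.cosh_sq, show 2 * (s / 2 / r) = s / r by ring] at hc
        rw [hc]
        ring_nf
      · ring_nf
  refine key.congr' ?_
  filter_upwards [eventually_gt_atTop 0] with r hr
  have h := integral_comp_mul_left_Ioi
    (fun t ↦ Real.exp (-r ^ 2 * Real.cosh t + ν * t)) 0 (inv_pos.2 hr)
  rw [mul_zero, inv_inv, smul_eq_mul] at h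
  rw [expCoshIntegral, mul_right_comm, ← h, mul_comm, ← integral_const_mul]
  refine integral_congr_ae (ae_of_all _ fun s ↦ ?_)
  simp only [← Real.exp_add]
  ring_nf

lemma tendsto_expCosIntegral (ν : ℝ) :
    Tendsto (fun r : ℝ ↦ r * Real.exp (-r ^ 2) * expCosIntegral ν (r ^ 2)) atTop
      (𝓝 (√(2 * Real.pi) / 2)) := by
  rw [← integral_exp_neg_sq_div_two_Ioi]
  have key : Tendsto (fun r : ℝ ↦ ∫ s in Ioi (0:ℝ), (Ioc 0 (r * Real.pi)).indicator
      (fun s ↦ Real.exp (-(r ^ 2 * (1 - Real.cos (s / r)))) * Real.cos (ν * (s / r))) s) atTop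
      (𝓝 (∫ s in Ioi (0:ℝ), Real.exp (-(s ^ 2 / 2)))) := by
    refine tendsto_integral_filter_of_dominated_convergence
      (fun s ↦ Real.exp (-(2 / Real.pi ^ 2) * s ^ 2))
      (Eventually.of_forall fun r ↦ ((by fun_prop : Continuous _).aestronglyMeasurable).indicator
        measurableSet_Ioc) ?_
      (integrable_exp_neg_mul_sq (by positivity)).integrableOn ?_
    · filter_upwards [eventually_gt_atTop 0] with r hr
      refine ae_of_all _ fun s ↦ ?_
      by_cases hs : s ∈ Ioc 0 (r * Real.pi)
      · rw [indicator_of_mem hs, norm_mul, Real.norm_eq_abs, Real.norm_eq_abs, Real.abs_exp]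
        have h₁ : 2 / Real.pi ^ 2 * s ^ 2 ≤ r ^ 2 * (1 - Real.cos (s / r)) := calc
          2 / Real.pi ^ 2 * s ^ 2 = r ^ 2 * (2 / Real.pi ^ 2 * (s / r) ^ 2) := by field_simp
          _ ≤ _ := by
            have hsr : |s / r| ≤ Real.pi := by
              rw [abs_of_pos (div_pos hs.1 hr), div_le_iff₀ hr, mul_comm]
              exact hs.2
            gcongr
            linarith [Real.cos_le_one_sub_mul_cos_sq hsr]
        calc _ ≤ Real.exp (-(2 / Real.pi ^ 2) * s ^ 2) * 1 := by
              gcongr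
              · linarith
              · exact Real.abs_cos_le_one _
          _ = _ := mul_one _
      · rw [indicator_of_notMem hs, norm_zero]
        positivity
    · filter_upwards [ae_restrict_mem measurableSet_Ioi] with s hs
      have h₁ := tendsto_mul_comp_div_atTop (by simpa using Real.hasDerivAt_sin 0)
        Real.sin_zero (s / 2)
      have h₂ : Tendsto (fun r : ℝ ↦ s / r) atTop (𝓝 0) :=
        tendsto_const_nhds.div_atTop tendsto_id
      have h₃ := ((h₁.pow 2).const_mul 2).neg.rexp.mul
        ((Real.continuous_cos.tendsto _).comp (h₂.const_mul ν))
      have h₄ : Real.exp (-(2 * (s / 2) ^ 2)) * Real.cos (ν * 0) = Real.exp (-(s ^ 2 / 2)) := by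
        rw [mul_zero, Real.cos_zero, mul_one]
        ring_nf
      rw [h₄] at h₃
      refine h₃.congr' ?_
      filter_upwards [eventually_ge_atTop (s / Real.pi)] with r hr
      have hmem : s ∈ Ioc 0 (r * Real.pi) := ⟨hs, (div_le_iff₀ Real.pi_pos).1 hr⟩
      rw [indicator_of_mem hmem]
      have hc := Real.cos_two_mul (s / 2 / r)
      rw [Real.cos_sq', show 2 * (s / 2 / r) = s / r by ring] at hc
      rw [hc]
      simp only [Function.comp_apply]
      ring_nf
  refine key.congr' ?_
  filter_upwards [eventually_gt_atTop 0] with r hr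
  have h := intervalIntegral.integral_comp_mul_left (a := 0) (b := r * Real.pi)
    (fun θ ↦ Real.exp (r ^ 2 * Real.cos θ) * Real.cos (ν * θ)) (inv_ne_zero hr.ne')
  rw [mul_zero, inv_inv, smul_eq_mul, inv_mul_cancel_left₀ hr.ne'] at h
  rw [setIntegral_indicator measurableSet_Ioc,
    inter_eq_self_of_subset_right Ioc_subset_Ioi_self, expCosIntegral, mul_right_comm, ← h,
    mul_comm _ (Real.exp _), ← intervalIntegral.integral_const_mul,
    intervalIntegral.integral_of_le (by positivity)]
  refine integral_congr_ae (ae_of_all _ fun s ↦ ?_)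
  simp only [← mul_assoc, ← Real.exp_add]
  ring_nf

lemma besselK_eq (ν : ℝ) {y : ℝ} (hy : 0 < y) :
    besselK ν y = (expCoshIntegral ν y + expCoshIntegral (-ν) y) / 2 := by
  rw [expCoshIntegral, expCoshIntegral,
    ← integral_add (integrable_exp_neg_mul_cosh_add_mul hy _).integrableOn
      (integrable_exp_neg_mul_cosh_add_mul hy _).integrableOn, ← integral_div, besselK]
  refine integral_congr_ae (ae_of_all _ fun t ↦ ?_)
  simp only [Real.exp_add, Real.cosh_eq (ν * t), neg_mul ν]
  ring

lemma besselI_eq (ν y : ℝ) :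
    besselI ν y = expCosIntegral ν y / Real.pi
      - Real.sin (ν * Real.pi) / Real.pi * expCoshIntegral (-ν) y := by
  simp only [besselI, expCosIntegral, expCoshIntegral, neg_mul ν, ← sub_eq_add_neg]
  rw [intervalIntegral.integral_sub ((by fun_prop : Continuous _).intervalIntegrable _ _)
    intervalIntegrable_const, intervalIntegral.integral_const, smul_eq_mul]
  field_simp
  ring

lemma hasDerivAt_besselK (ν : ℝ) {y : ℝ} (hy : 0 < y) :
    HasDerivAt (besselK ν) (-(besselK (ν + 1) y + besselK (ν - 1) y) / 2) y := by
  have h := ((hasDerivAt_expCoshIntegral ν hy).add (hasDerivAt_expCoshIntegral (-ν) hy)).div_const 2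
  have he : besselK ν =ᶠ[𝓝 y] fun y ↦ (expCoshIntegral ν y + expCoshIntegral (-ν) y) / 2 := by
    filter_upwards [Ioi_mem_nhds hy] with x hx using besselK_eq ν hx
  refine (h.congr_of_eventuallyEq he).congr_deriv ?_
  rw [besselK_eq _ hy, besselK_eq _ hy, neg_add' ν 1, neg_sub' ν 1, sub_neg_eq_add]
  ring

lemma besselK_recurrence (ν : ℝ) {y : ℝ} (hy : 0 < y) :
    y * (besselK (ν + 1) y - besselK (ν - 1) y) = 2 * ν * besselK ν y := by
  have h₁ := expCoshIntegral_recurrence ν hy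
  have h₂ := expCoshIntegral_recurrence (-ν) hy
  rw [besselK_eq _ hy, besselK_eq _ hy, besselK_eq _ hy, neg_add' ν 1, neg_sub' ν 1, sub_neg_eq_add]
  linarith

lemma hasDerivAt_besselI (ν : ℝ) {y : ℝ} (hy : 0 < y) :
    HasDerivAt (besselI ν) ((besselI (ν + 1) y + besselI (ν - 1) y) / 2) y := by
  have h := ((hasDerivAt_expCosIntegral ν y).div_const Real.pi).sub
    ((hasDerivAt_expCoshIntegral (-ν) hy).const_mul (Real.sin (ν * Real.pi) / Real.pi))
  rw [show besselI ν = _ from funext (besselI_eq ν)]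
  refine h.congr_deriv ?_
  rw [besselI_eq, besselI_eq, neg_add' ν 1, neg_sub' ν 1, sub_neg_eq_add, add_mul, sub_mul, one_mul,
    Real.sin_add_pi, Real.sin_sub_pi]
  ring

lemma besselI_recurrence (ν : ℝ) {y : ℝ} (hy : 0 < y) :
    y * (besselI (ν - 1) y - besselI (ν + 1) y) = 2 * ν * besselI ν y := by
  have h₁ := expCosIntegral_recurrence ν y
  have h₂ := expCoshIntegral_recurrence (-ν) hy
  rw [besselI_eq, besselI_eq, besselI_eq, neg_add' ν 1, neg_sub' ν 1, sub_neg_eq_add, add_mul,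
    sub_mul,
    one_mul, Real.sin_add_pi, Real.sin_sub_pi]
  linear_combination (-2 / Real.pi) * h₁ + 2 * Real.sin (ν * Real.pi) / Real.pi * h₂

lemma tendsto_besselK (ν : ℝ) :
    Tendsto (fun r : ℝ ↦ r * Real.exp (r ^ 2) * besselK ν (r ^ 2)) atTop
      (𝓝 (√(2 * Real.pi) / 2)) := by
  have h := ((tendsto_expCoshIntegral ν).add (tendsto_expCoshIntegral (-ν))).div_const 2
  rw [add_self_div_two] at h
  refine h.congr' ?_
  filter_upwards [eventually_gt_atTop 0] with r hr
  rw [besselK_eq ν (by positivity)]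
  ring

lemma tendsto_besselI (ν : ℝ) :
    Tendsto (fun r : ℝ ↦ r * Real.exp (-r ^ 2) * besselI ν (r ^ 2)) atTop
      (𝓝 (√(2 * Real.pi) / 2 / Real.pi)) := by
  have he : Tendsto (fun r : ℝ ↦ Real.exp (-r ^ 2) ^ 2) atTop (𝓝 0) := by
    have h : Tendsto (fun r : ℝ ↦ Real.exp (-r ^ 2)) atTop (𝓝 0) :=
      Real.tendsto_exp_neg_atTop_nhds_zero.comp (tendsto_pow_atTop two_ne_zero)
    simpa using h.pow 2
  have h := ((tendsto_expCosIntegral ν).div_const Real.pi).sub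
    ((he.mul (tendsto_expCoshIntegral (-ν))).const_mul (Real.sin (ν * Real.pi) / Real.pi))
  rw [zero_mul, mul_zero, sub_zero] at h
  refine h.congr fun r ↦ ?_
  have hr : Real.exp (-r ^ 2) * Real.exp (r ^ 2) = 1 := by rw [← Real.exp_add]; simp
  rw [besselI_eq]
  linear_combination (-Real.sin (ν * Real.pi) / Real.pi * r * Real.exp (-r ^ 2)
    * expCoshIntegral (-ν) (r ^ 2)) * hr

lemma besselI_mul_besselK_add (ν : ℝ) {y : ℝ} (hy : 0 < y) :
    y * (besselI ν y * besselK (ν + 1) y + besselI (ν + 1) y * besselK ν y) = 1 := by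
  set f : ℝ → ℝ := fun y ↦
    y * (besselI ν y * besselK (ν + 1) y + besselI (ν + 1) y * besselK ν y)
  have hf (x : ℝ) (hx : 0 < x) : HasDerivAt f 0 x := by
    have h := (hasDerivAt_id x).mul (((hasDerivAt_besselI ν hx).mul
      (hasDerivAt_besselK (ν + 1) hx)).add
        ((hasDerivAt_besselI (ν + 1) hx).mul (hasDerivAt_besselK ν hx)))
    refine h.congr_deriv ?_
    have h₁ := besselI_recurrence ν hx
    have h₂ := besselI_recurrence (ν + 1) hx
    have h₃ := besselK_recurrence ν hx
    have h₄ := besselK_recurrence (ν + 1) hx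
    rw [add_sub_cancel_right] at h₂ h₄ ⊢
    simp only [id, Pi.add_apply, Pi.mul_apply]
    linear_combination besselK (ν + 1) x / 2 * h₁ - besselK ν x / 2 * h₂
      + besselI (ν + 1) x / 2 * h₃ - besselI ν x / 2 * h₄
  have hconst (x : ℝ) (hx : 0 < x) : f x = f y :=
    isOpen_Ioi.is_const_of_deriv_eq_zero isPreconnected_Ioi
      (fun u hu ↦ (hf u hu).differentiableAt.differentiableWithinAt)
      (fun u hu ↦ (hf u hu).deriv) hx hy
  have hlim := ((tendsto_besselI ν).mul (tendsto_besselK (ν + 1))).add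
    ((tendsto_besselI (ν + 1)).mul (tendsto_besselK ν))
  have hone : √(2 * Real.pi) / 2 / Real.pi * (√(2 * Real.pi) / 2)
      + √(2 * Real.pi) / 2 / Real.pi * (√(2 * Real.pi) / 2) = 1 := by
    have hp := Real.pi_pos
    have hs := Real.sq_sqrt (by positivity : 0 ≤ 2 * Real.pi)
    field_simp
    linarith
  rw [hone] at hlim
  refine tendsto_nhds_unique (Tendsto.congr' ?_ tendsto_const_nhds) hlim
  filter_upwards [eventually_gt_atTop 0] with r hr
  have hr' : Real.exp (-r ^ 2) * Real.exp (r ^ 2) = 1 := by rw [← Real.exp_add]; simp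
  change f y = _
  rw [← hconst (r ^ 2) (by positivity)]
  simp only [f]
  linear_combination (-r ^ 2 * (besselI ν (r ^ 2) * besselK (ν + 1) (r ^ 2)
    + besselI (ν + 1) (r ^ 2) * besselK ν (r ^ 2))) * hr'

lemma wronskian_besselI_besselK (ν : ℝ) {y : ℝ} (hy : 0 < y) :
    y * (besselI ν y * deriv (besselK ν) y - deriv (besselI ν) y * besselK ν y) = -1 := by
  rw [(hasDerivAt_besselI ν hy).deriv, (hasDerivAt_besselK ν hy).deriv]
  linear_combination -besselI_mul_besselK_add ν hy
    - besselK ν y / 2 * besselI_recurrence ν hy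
    + besselI ν y / 2 * besselK_recurrence ν hy

/-- For an integer `n ≥ 3` and `λ > 0`, the Wronskian of `G` and `D` is constant:
`G(z)·D'(z) − G'(z)·D(z) = −n/2` for all `z > 0`. -/
theorem wronskian_calG_calD (n : ℕ) (hn : 3 ≤ n) (lam : ℝ) (hlam : 0 < lam)
    (z : ℝ) (hz : 0 < z) :
    calG n lam z * deriv (calD n lam) z - deriv (calG n lam) z * calD n lam z
      = -(n : ℝ) / 2 := by
  have hn0 : (0:ℝ) < n := by exact_mod_cast (by omega : 0 < n)
  set c : ℝ := 2 * Real.sqrt (lam / n)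
  have hc : 0 < c := by positivity
  set w : ℝ → ℝ := fun x ↦ c * x ^ ((n : ℝ) / 2) with hw
  have hwz : 0 < w z := by positivity
  have hw' : HasDerivAt w (w z * (n / 2) / z) z := by
    refine ((Real.hasDerivAt_rpow_const (Or.inl hz.ne')).const_mul c).congr_deriv ?_
    rw [Real.rpow_sub_one hz.ne', hw]
    ring
  have hs := Real.hasDerivAt_sqrt hz.ne'
  have hD : HasDerivAt (calD n lam) _ z :=
    hs.mul ((hasDerivAt_besselK (1 / n) hwz).differentiableAt.hasDerivAt.comp z hw')
  have hG : HasDerivAt (calG n lam) _ z :=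
    hs.mul ((hasDerivAt_besselI (1 / n) hwz).differentiableAt.hasDerivAt.comp z hw')
  have hW := wronskian_besselI_besselK (1 / n) hwz
  have hD0 : calD n lam z = √z * besselK (1 / n) (w z) := rfl
  have hG0 : calG n lam z = √z * besselI (1 / n) (w z) := rfl
  have hzz : √z * √z / z = 1 := by rw [Real.mul_self_sqrt hz.le, div_self hz.ne']
  rw [hD.deriv, hG.deriv, hD0, hG0]
  linear_combination (n / 2 : ℝ) * hW + (n / 2 : ℝ) * (w z * (besselI (1 / n) (w z)
    * deriv (besselK (1 / n)) (w z)
    - deriv (besselI (1 / n)) (w z) * besselK (1 / n) (w z))) * hzz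
end

section
/- Let n ≥ 3 be an integer and λ₁ > 0. There exists a constant C > 1 depending only on n such that for every λ ≥ λ₁ and every z > (n/(4λ₁))^{1/n}: C^{-1} · e^{−(2/√n)·√λ·z^{n/2}} / (λ^{1/4}·z^{(n−2)/4}) < D(z) < C · e^{−(2/√n)·√λ·z^{n/2}} / (λ^{1/4}·z^{(n−2)/4}), and C^{-1} · e^{(2/√n)·√λ·z^{n/2}} / (λ^{1/4}·z^{(n−2)/4}) < G(z) < C · e^{(2/√n)·√λ·z^{n/2}} / (λ^{1/4}·z^{(n−2)/4}). -/
open Real MeasureTheory Set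

lemma cosh_le_one_add_sq {t : ℝ} (h0 : 0 ≤ t) (h1 : t ≤ 1) : cosh t ≤ 1 + t ^ 2 := by
  have h := Real.cosh_le_exp_half_sq t
  have hs : |t ^ 2 / 2| ≤ 1 := by
    rw [abs_of_nonneg (by positivity)]; nlinarith
  have h2 := (abs_le.mp (Real.abs_exp_sub_one_sub_id_le hs)).2
  nlinarith [sq_nonneg t, mul_nonneg h0 (sub_nonneg.mpr h1)]

lemma one_add_half_sq_le_cosh (t : ℝ) : 1 + t ^ 2 / 2 ≤ cosh t := by
  have h := Real.cosh_sq (t / 2)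
  have h2 := Real.cosh_two_mul (t / 2)
  rw [mul_div_cancel₀ t two_ne_zero] at h2
  have h3 : (t / 2) ^ 2 ≤ sinh (t / 2) ^ 2 := by
    rw [sq_le_sq, Real.abs_sinh]
    exact Real.self_le_sinh_iff.mpr (abs_nonneg _)
  nlinarith

lemma besselK_integrand_le {ν y t : ℝ} (hν0 : 0 ≤ ν) (hν1 : ν ≤ 1) (hy : 1 ≤ y) (ht : 0 ≤ t) :
    exp (-y * cosh t) * cosh (ν * t) ≤ exp (1 - y) * exp (-(y / 4) * t ^ 2) := by
  have h1 : cosh (ν * t) ≤ exp t := by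
    have hνt : 0 ≤ ν * t := mul_nonneg hν0 ht
    rw [Real.cosh_eq]
    have a : exp (ν * t) ≤ exp t := exp_le_exp.mpr (by nlinarith)
    have b : exp (-(ν * t)) ≤ exp t := exp_le_exp.mpr (by linarith)
    linarith
  calc exp (-y * cosh t) * cosh (ν * t) ≤ exp (-y * cosh t) * exp t := by gcongr
    _ ≤ exp (1 - y) * exp (-(y / 4) * t ^ 2) := by
      rw [← exp_add, ← exp_add]
      apply exp_le_exp.mpr
      have := mul_le_mul_of_nonneg_left (one_add_half_sq_le_cosh t) (by linarith : 0 ≤ y)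
      nlinarith [sq_nonneg (t / 2 - 1), mul_nonneg (sub_nonneg.mpr hy) (sq_nonneg t)]

lemma integrableOn_besselK_integrand {ν y : ℝ} (hν0 : 0 ≤ ν) (hν1 : ν ≤ 1) (hy : 1 ≤ y) :
    IntegrableOn (fun t => exp (-y * cosh t) * cosh (ν * t)) (Ioi 0) := by
  have hg : IntegrableOn (fun t : ℝ => exp (1 - y) * exp (-(y / 4) * t ^ 2)) (Ioi 0) :=
    ((integrable_exp_neg_mul_sq (by linarith : 0 < y / 4)).const_mul _).integrableOn
  refine Integrable.mono' hg ?_ ?_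
  · exact (by fun_prop : Continuous fun t => exp (-y * cosh t) * cosh (ν * t)).aestronglyMeasurable
  · refine (ae_restrict_iff' measurableSet_Ioi).mpr (.of_forall fun t ht => ?_)
    rw [Real.norm_of_nonneg (by positivity)]
    exact besselK_integrand_le hν0 hν1 hy (le_of_lt ht)

lemma besselK_le {ν y : ℝ} (hν0 : 0 ≤ ν) (hν1 : ν ≤ 1) (hy : 1 ≤ y) :
    besselK ν y ≤ exp 1 * √π * (exp (-y) / √y) := by
  have hg : IntegrableOn (fun t : ℝ => exp (1 - y) * exp (-(y / 4) * t ^ 2)) (Ioi 0) :=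
    ((integrable_exp_neg_mul_sq (by linarith : 0 < y / 4)).const_mul _).integrableOn
  have hle := setIntegral_mono_on (integrableOn_besselK_integrand hν0 hν1 hy) hg
    measurableSet_Ioi fun t ht => besselK_integrand_le hν0 hν1 hy (le_of_lt ht)
  rw [integral_const_mul, integral_gaussian_Ioi] at hle
  refine hle.trans_eq ?_
  have hsq : √(π / (y / 4)) = 2 * (√π / √y) := by
    rw [show π / (y / 4) = 2 ^ 2 * (π / y) by field_simp; norm_num, Real.sqrt_mul (by positivity),
      Real.sqrt_sq (by norm_num), Real.sqrt_div pi_pos.le]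
  rw [hsq, sub_eq_add_neg, exp_add]
  ring

lemma le_besselK {ν y : ℝ} (hν0 : 0 ≤ ν) (hν1 : ν ≤ 1) (hy : 1 ≤ y) :
    exp (-1) * (exp (-y) / √y) ≤ besselK ν y := by
  have hint := integrableOn_besselK_integrand hν0 hν1 hy
  have hs : 1 ≤ √y := Real.one_le_sqrt.mpr hy
  have hsub : Ioc 0 (1 / √y) ⊆ Ioi 0 := Ioc_subset_Ioi_self
  have h1 : ∫ t in Ioc 0 (1 / √y), exp (-y * cosh t) * cosh (ν * t) ≤ besselK ν y :=
    setIntegral_mono_set hint (.of_forall fun t => by positivity) hsub.eventuallyLE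
  have h2 : ∫ _ in Ioc 0 (1 / √y), exp (-1 - y) ≤
      ∫ t in Ioc 0 (1 / √y), exp (-y * cosh t) * cosh (ν * t) := by
    refine setIntegral_mono_on (by simp) (hint.mono_set hsub) measurableSet_Ioc fun t ht => ?_
    have ht1 : t ≤ 1 := ht.2.trans (by rw [div_le_one (by linarith)]; exact hs)
    have hyt : y * t ^ 2 ≤ 1 := by
      have : t * √y ≤ 1 := (le_div_iff₀ (by linarith)).mp ht.2
      have hsq : √y ^ 2 = y := Real.sq_sqrt (by linarith)
      have h0 : 0 ≤ t * √y := mul_nonneg ht.1.le (by linarith)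
      calc y * t ^ 2 = (t * √y) ^ 2 := by rw [mul_pow, hsq]; ring
        _ ≤ 1 := pow_le_one₀ h0 this
    have hc := mul_le_mul_of_nonneg_left (cosh_le_one_add_sq ht.1.le ht1) (by linarith : 0 ≤ y)
    calc exp (-1 - y) ≤ exp (-y * cosh t) := exp_le_exp.mpr (by linarith)
      _ ≤ _ := le_mul_of_one_le_right (exp_pos _).le (Real.one_le_cosh _)
  refine le_trans (le_of_eq ?_) (h2.trans h1)
  rw [setIntegral_const, smul_eq_mul, Real.volume_real_Ioc_of_le (by positivity),
    sub_eq_add_neg (-1) y, exp_add]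
  ring

lemma integral_exp_neg_mul_cosh_sub_le {ν y : ℝ} (hν0 : 0 ≤ ν) (hy : 1 ≤ y) :
    ∫ t in Ioi (0 : ℝ), exp (-y * cosh t - ν * t) ≤ √(π / 2) * (exp (-y) / √y) := by
  have hg : IntegrableOn (fun t : ℝ => exp (-y) * exp (-(y / 2) * t ^ 2)) (Ioi 0) :=
    ((integrable_exp_neg_mul_sq (by linarith : 0 < y / 2)).const_mul _).integrableOn
  have hle : ∀ t ∈ Ioi (0 : ℝ),
      exp (-y * cosh t - ν * t) ≤ exp (-y) * exp (-(y / 2) * t ^ 2) := by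
    intro t ht
    rw [← exp_add]
    apply exp_le_exp.mpr
    have := mul_le_mul_of_nonneg_left (one_add_half_sq_le_cosh t) (by linarith : 0 ≤ y)
    have := mul_nonneg hν0 (le_of_lt ht)
    nlinarith
  have hf : IntegrableOn (fun t => exp (-y * cosh t - ν * t)) (Ioi 0) := by
    refine Integrable.mono' hg ?_ ?_
    · exact (by fun_prop : Continuous fun t => exp (-y * cosh t - ν * t)).aestronglyMeasurable
    · refine (ae_restrict_iff' measurableSet_Ioi).mpr (.of_forall fun t ht => ?_)
      rw [Real.norm_of_nonneg (by positivity)]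
      exact hle t ht
  refine (setIntegral_mono_on hf hg measurableSet_Ioi hle).trans_eq ?_
  have hsq : √(π / (y / 2)) = 2 * (√(π / 2) / √y) := by
    rw [show π / (y / 2) = 2 ^ 2 * ((π / 2) / y) by field_simp,
      Real.sqrt_mul (by positivity), Real.sqrt_sq (by norm_num), Real.sqrt_div (by positivity)]
  rw [integral_const_mul, integral_gaussian_Ioi, hsq]
  ring

lemma integral_exp_mul_cos_mul_cos_le {ν y : ℝ} (hy : 0 < y) :
    ∫ θ in (0 : ℝ)..π, exp (y * cos θ) * cos (ν * θ) ≤ π * √(π / 2) / 2 * (exp y / √y) := by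
  have hg : IntegrableOn (fun t : ℝ => exp y * exp (-(2 * y / π ^ 2) * t ^ 2)) (Ioi 0) :=
    ((integrable_exp_neg_mul_sq (by positivity)).const_mul _).integrableOn
  have hsub : Ioc 0 π ⊆ Ioi 0 := Ioc_subset_Ioi_self
  have hf : Continuous fun θ => exp (y * cos θ) * cos (ν * θ) := by fun_prop
  rw [intervalIntegral.integral_of_le pi_pos.le]
  have h1 : ∫ θ in Ioc 0 π, exp (y * cos θ) * cos (ν * θ) ≤
      ∫ t in Ioc 0 π, exp y * exp (-(2 * y / π ^ 2) * t ^ 2) := by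
    refine setIntegral_mono_on hf.integrableOn_Ioc (hg.mono_set hsub) measurableSet_Ioc
      fun t ht => ?_
    calc exp (y * cos t) * cos (ν * t) ≤ exp (y * cos t) :=
          mul_le_of_le_one_right (exp_pos _).le (cos_le_one _)
      _ ≤ _ := by
        rw [← exp_add]
        apply exp_le_exp.mpr
        have hc := Real.cos_le_one_sub_mul_cos_sq (x := t)
          (by rw [abs_of_pos ht.1]; exact ht.2)
        have := mul_le_mul_of_nonneg_left hc hy.le
        calc _ ≤ _ := this
          _ = _ := by ring
  have h2 : ∫ t in Ioc 0 π, exp y * exp (-(2 * y / π ^ 2) * t ^ 2) ≤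
      ∫ t in Ioi (0 : ℝ), exp y * exp (-(2 * y / π ^ 2) * t ^ 2) :=
    setIntegral_mono_set hg (.of_forall fun t => by positivity) hsub.eventuallyLE
  refine (h1.trans h2).trans_eq ?_
  have hsq : √(π / (2 * y / π ^ 2)) = π * (√(π / 2) / √y) := by
    rw [show π / (2 * y / π ^ 2) = π ^ 2 * ((π / 2) / y) by field_simp,
      Real.sqrt_mul (by positivity), Real.sqrt_sq pi_pos.le, Real.sqrt_div (by positivity)]
  rw [integral_const_mul, integral_gaussian_Ioi, hsq]
  ring

lemma le_integral_exp_mul_cos_mul_cos {ν y : ℝ} (hν0 : 0 ≤ ν) (hν1 : ν ≤ 1 / 3) (hy : 1 ≤ y) :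
    exp (-(1 / 2)) / 2 * (exp y / √y) ≤
      ∫ θ in (0 : ℝ)..π, exp (y * cos θ) * cos (ν * θ) := by
  have hs : 1 ≤ √y := Real.one_le_sqrt.mpr hy
  have hle1 : 1 / √y ≤ 1 := by rw [div_le_one (by linarith)]; exact hs
  have hcos : ∀ t ∈ Ioc 0 π, 1 / 2 ≤ cos (ν * t) := by
    intro t ht
    rw [← Real.cos_pi_div_three]
    apply Real.cos_le_cos_of_nonneg_of_le_pi (mul_nonneg hν0 ht.1.le) (by linarith [pi_pos])
    nlinarith [ht.1, ht.2, mul_le_mul hν1 ht.2 ht.1.le (by norm_num)]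
  have hf : Continuous fun θ => exp (y * cos θ) * cos (ν * θ) := by fun_prop
  have hsub : Ioc 0 (1 / √y) ⊆ Ioc 0 π := Ioc_subset_Ioc_right (by linarith [pi_gt_three])
  rw [intervalIntegral.integral_of_le pi_pos.le]
  have h1 : ∫ t in Ioc 0 (1 / √y), exp (y * cos t) * cos (ν * t) ≤
      ∫ t in Ioc 0 π, exp (y * cos t) * cos (ν * t) := by
    refine setIntegral_mono_set hf.integrableOn_Ioc ?_ hsub.eventuallyLE
    refine (ae_restrict_iff' measurableSet_Ioc).mpr (.of_forall fun t ht => ?_)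
    exact mul_nonneg (exp_pos _).le (by linarith [hcos t ht])
  have h2 : ∫ _ in Ioc 0 (1 / √y), exp (y - 1 / 2) * (1 / 2) ≤
      ∫ t in Ioc 0 (1 / √y), exp (y * cos t) * cos (ν * t) := by
    refine setIntegral_mono_on continuous_const.integrableOn_Ioc hf.integrableOn_Ioc measurableSet_Ioc fun t ht => ?_
    have hyt : y * t ^ 2 ≤ 1 := by
      have : t * √y ≤ 1 := (le_div_iff₀ (by linarith)).mp ht.2
      have hsq : √y ^ 2 = y := Real.sq_sqrt (by linarith)
      have h0 : 0 ≤ t * √y := mul_nonneg ht.1.le (by linarith)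
      calc y * t ^ 2 = (t * √y) ^ 2 := by rw [mul_pow, hsq]; ring
        _ ≤ 1 := pow_le_one₀ h0 this
    have hc := mul_le_mul_of_nonneg_left (Real.one_sub_sq_div_two_le_cos (x := t))
      (by linarith : 0 ≤ y)
    exact mul_le_mul (exp_le_exp.mpr (by linarith)) (hcos t (hsub ht)) (by norm_num) (exp_pos _).le
  refine le_trans (le_of_eq ?_) (h2.trans h1)
  rw [setIntegral_const, smul_eq_mul, Real.volume_real_Ioc_of_le (by positivity),
    sub_eq_add_neg y, exp_add]
  ring

lemma sin_mul_pi_nonneg {ν : ℝ} (hν0 : 0 ≤ ν) (hν1 : ν ≤ 1) : 0 ≤ sin (ν * π) :=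
  Real.sin_nonneg_of_nonneg_of_le_pi (by positivity) (by nlinarith [pi_pos])

lemma besselI_eq_s10 (ν y : ℝ) :
    besselI ν y = 1 / π * ((∫ θ in (0 : ℝ)..π, exp (y * cos θ) * cos (ν * θ)) -
      sin (ν * π) * ∫ t in Ioi (0 : ℝ), exp (-y * cosh t - ν * t)) := by
  have hf : Continuous fun θ => exp (y * cos θ) * cos (ν * θ) := by fun_prop
  unfold besselI
  rw [intervalIntegral.integral_sub (hf.intervalIntegrable _ _) intervalIntegrable_const,
    intervalIntegral.integral_const, smul_eq_mul]
  field_simp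
  ring

lemma besselI_le {ν y : ℝ} (hν0 : 0 ≤ ν) (hν1 : ν ≤ 1) (hy : 0 < y) :
    besselI ν y ≤ √(π / 2) / 2 * (exp y / √y) := by
  have h1 := integral_exp_mul_cos_mul_cos_le (ν := ν) hy
  have h2 : 0 ≤ sin (ν * π) * ∫ t in Ioi (0 : ℝ), exp (-y * cosh t - ν * t) :=
    mul_nonneg (sin_mul_pi_nonneg hν0 hν1) (integral_nonneg fun t => (exp_pos _).le)
  rw [besselI_eq_s10, show √(π / 2) / 2 * (exp y / √y) =
    1 / π * (π * √(π / 2) / 2 * (exp y / √y)) by field_simp]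
  gcongr
  linarith

lemma le_besselI {ν y : ℝ} (hν0 : 0 ≤ ν) (hν1 : ν ≤ 1 / 3) (hy : 1 ≤ y) :
    1 / (10 * π) * (exp y / √y) ≤ besselI ν y := by
  have hs : 0 < √y := Real.sqrt_pos.mpr (by linarith)
  have h1 := le_integral_exp_mul_cos_mul_cos hν0 hν1 hy
  have h2 := integral_exp_neg_mul_cosh_sub_le hν0 hy
  have h0 : 0 ≤ ∫ t in Ioi (0 : ℝ), exp (-y * cosh t - ν * t) :=
    integral_nonneg fun t => (exp_pos _).le
  have h3 : sin (ν * π) * ∫ t in Ioi (0 : ℝ), exp (-y * cosh t - ν * t) ≤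
      √(π / 2) * (exp (-y) / √y) :=
    (mul_le_of_le_one_left h0 (sin_le_one _)).trans h2
  have hexp : exp (-y) ≤ 0.14 * exp y := by
    have e1 : (2.7 : ℝ) < exp 1 := by linarith [exp_one_gt_d9]
    have e2 : exp (-y) * exp y = 1 := by rw [← exp_add]; simp
    have e3 : exp 1 ≤ exp y := exp_le_exp.mpr hy
    nlinarith [exp_pos y, exp_pos (-y)]
  have hhalf : (0.6 : ℝ) ≤ exp (-(1 / 2)) := by
    have e1 : exp (-(1 / 2)) * exp (-(1 / 2)) * exp 1 = 1 := by
      rw [← exp_add, ← exp_add]; norm_num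
    by_contra! hlt
    have : exp (-(1 / 2)) * exp (-(1 / 2)) ≤ 0.6 * 0.6 := by
      gcongr
    nlinarith [exp_one_lt_d9, exp_pos 1]
  have hpi : √(π / 2) ≤ 1.26 := by
    rw [Real.sqrt_le_left (by norm_num)]
    nlinarith [pi_lt_d4]
  have h4 : 1 / 10 * (exp y / √y) ≤
      exp (-(1 / 2)) / 2 * (exp y / √y) - √(π / 2) * (exp (-y) / √y) := by
    rw [← mul_div_assoc, ← mul_div_assoc, ← mul_div_assoc, ← sub_div]
    gcongr
    have a := mul_le_mul hpi hexp (exp_pos _).le (by norm_num)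
    have b := mul_le_mul_of_nonneg_right hhalf (exp_pos y).le
    nlinarith [exp_pos y]
  rw [besselI_eq_s10, show 1 / (10 * π) * (exp y / √y) = 1 / π * (1 / 10 * (exp y / √y)) by
    field_simp]
  gcongr
  linarith

lemma bessel_argument_gt_one {n : ℕ} (hn : 0 < n) {lam1 lam z : ℝ} (h1 : 0 < lam1)
    (hle : lam1 ≤ lam) (hz : ((n : ℝ) / (4 * lam1)) ^ (1 / (n : ℝ)) < z) :
    1 < 2 * √(lam / n) * z ^ ((n : ℝ) / 2) := by
  have hn' : (0 : ℝ) < n := by exact_mod_cast hn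
  have hlam : 0 < lam := h1.trans_le hle
  have hb : 0 < (n : ℝ) / (4 * lam1) := by positivity
  have hlt := Real.rpow_lt_rpow (by positivity) hz (by positivity : 0 < (n : ℝ) / 2)
  rw [← Real.rpow_mul hb.le, show 1 / (n : ℝ) * (n / 2) = 1 / 2 by field_simp,
    ← Real.sqrt_eq_rpow] at hlt
  have hone : 1 ≤ 2 * √(lam / n) * √(n / (4 * lam1)) := by
    rw [mul_assoc, ← Real.sqrt_mul (by positivity)]
    have : √(1 / 4) ≤ √(lam / n * (n / (4 * lam1))) := by
      apply Real.sqrt_le_sqrt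
      rw [show lam / n * (n / (4 * lam1)) = lam / lam1 / 4 by field_simp]
      have : 1 ≤ lam / lam1 := (one_le_div h1).mpr hle
      linarith
    have h4 : √(1 / 4 : ℝ) = 1 / 2 := by
      rw [show (1 / 4 : ℝ) = (1 / 2) ^ 2 by norm_num, Real.sqrt_sq (by norm_num)]
    linarith
  refine hone.trans_lt ?_
  have : 0 < √(lam / n) := Real.sqrt_pos.mpr (by positivity)
  gcongr

lemma sqrt_mul_div_sqrt_bessel_argument {n lam z : ℝ} (hn : 0 < n) (hlam : 0 < lam) (hz : 0 < z)
    (E : ℝ) :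
    √z * (E / √(2 * √(lam / n) * z ^ (n / 2))) =
      n ^ ((1 : ℝ) / 4) / √2 * (E / (lam ^ ((1 : ℝ) / 4) * z ^ ((n - 2) / 4))) := by
  have h1 : √(2 * √(lam / n) * z ^ (n / 2)) =
      √2 * (lam ^ ((1 : ℝ) / 4) / n ^ ((1 : ℝ) / 4)) * (z ^ ((n - 2) / 4) * √z) := by
    rw [Real.sqrt_mul (by positivity), Real.sqrt_mul (by positivity)]
    congr 2
    · rw [Real.sqrt_eq_rpow, Real.sqrt_eq_rpow, ← Real.rpow_mul (by positivity),
        Real.div_rpow hlam.le hn.le]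
      norm_num
    · rw [Real.sqrt_eq_rpow, Real.sqrt_eq_rpow, ← Real.rpow_mul hz.le, ← Real.rpow_add hz]
      congr 1
      ring
  have hz' : 0 < √z := Real.sqrt_pos.mpr hz
  rw [h1]
  field_simp

lemma exists_bessel_bounds {ν : ℝ} (hν0 : 0 ≤ ν) (hν1 : ν ≤ 1 / 3) :
    ∃ a b : ℝ, 0 < a ∧ 0 < b ∧ ∀ y : ℝ, 1 ≤ y →
      (a * (exp (-y) / √y) ≤ besselK ν y ∧ besselK ν y ≤ b * (exp (-y) / √y)) ∧
      (a * (exp y / √y) ≤ besselI ν y ∧ besselI ν y ≤ b * (exp y / √y)) := by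
  refine ⟨min (exp (-1)) (1 / (10 * π)), max (exp 1 * √π) (√(π / 2) / 2), by positivity,
    by positivity, fun y hy => ?_⟩
  have hν : ν ≤ 1 := by linarith
  refine ⟨⟨le_trans ?_ (le_besselK hν0 hν hy), (besselK_le hν0 hν hy).trans ?_⟩,
    ⟨le_trans ?_ (le_besselI hν0 hν1 hy), (besselI_le hν0 hν (by linarith)).trans ?_⟩⟩ <;> gcongr
  exacts [min_le_left _ _, le_max_left _ _, min_le_right _ _, le_max_right _ _]

/-- For an integer `n ≥ 3` there is a constant `C > 1` depending only on `n` such that for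
every `λ₁ > 0`, every `λ ≥ λ₁` and every `z > (n/(4λ₁))^{1/n}`:
`C⁻¹·e^{−(2/√n)√λ z^{n/2}}/(λ^{1/4} z^{(n−2)/4}) < D(z) < C·e^{−(2/√n)√λ z^{n/2}}/(λ^{1/4} z^{(n−2)/4})`
and similarly for `G` with `e^{+(2/√n)√λ z^{n/2}}`. -/
theorem calD_calG_bounds (n : ℕ) (hn : 3 ≤ n) :
    ∃ C : ℝ, 1 < C ∧ ∀ lam1 : ℝ, 0 < lam1 → ∀ lam : ℝ, lam1 ≤ lam →
      ∀ z : ℝ, ((n : ℝ) / (4 * lam1)) ^ (1 / (n : ℝ)) < z →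
        (C⁻¹ * (Real.exp (-(2 / Real.sqrt n) * Real.sqrt lam * z ^ ((n : ℝ) / 2)) /
            (lam ^ ((1 : ℝ) / 4) * z ^ (((n : ℝ) - 2) / 4))) < calD n lam z ∧
          calD n lam z < C * (Real.exp (-(2 / Real.sqrt n) * Real.sqrt lam * z ^ ((n : ℝ) / 2)) /
            (lam ^ ((1 : ℝ) / 4) * z ^ (((n : ℝ) - 2) / 4)))) ∧
        (C⁻¹ * (Real.exp ((2 / Real.sqrt n) * Real.sqrt lam * z ^ ((n : ℝ) / 2)) /
            (lam ^ ((1 : ℝ) / 4) * z ^ (((n : ℝ) - 2) / 4))) < calG n lam z ∧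
          calG n lam z < C * (Real.exp ((2 / Real.sqrt n) * Real.sqrt lam * z ^ ((n : ℝ) / 2)) /
            (lam ^ ((1 : ℝ) / 4) * z ^ (((n : ℝ) - 2) / 4)))) := by
  have hn0 : (0 : ℝ) < n := by exact_mod_cast (by omega : 0 < n)
  obtain ⟨a, b, ha, hb, hab⟩ := exists_bessel_bounds (ν := 1 / (n : ℝ)) (by positivity)
    (one_div_le_one_div_of_le (by norm_num) (by exact_mod_cast hn))
  set S : ℝ := (n : ℝ) ^ ((1 : ℝ) / 4) / √2 with hS
  have hSpos : 0 < S := by positivity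
  refine ⟨1 + S * b + (S * a)⁻¹, by linarith [mul_pos hSpos hb, inv_pos.mpr (mul_pos hSpos ha)],
    fun lam1 hlam1 lam hle z hz => ?_⟩
  have hlam : 0 < lam := hlam1.trans_le hle
  have hz0 : 0 < z := lt_of_le_of_lt (by positivity) hz
  have hy := bessel_argument_gt_one (by omega) hlam1 hle hz
  have harg : 2 / √n * √lam * z ^ ((n : ℝ) / 2) = 2 * √(lam / n) * z ^ ((n : ℝ) / 2) := by
    rw [Real.sqrt_div hlam.le]; ring
  have key : ∀ E f : ℝ, 0 < E →
      a * (E / √(2 * √(lam / n) * z ^ ((n : ℝ) / 2))) ≤ f ∧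
        f ≤ b * (E / √(2 * √(lam / n) * z ^ ((n : ℝ) / 2))) →
      (1 + S * b + (S * a)⁻¹)⁻¹ * (E / (lam ^ ((1 : ℝ) / 4) * z ^ (((n : ℝ) - 2) / 4))) < √z * f ∧
        √z * f < (1 + S * b + (S * a)⁻¹) *
          (E / (lam ^ ((1 : ℝ) / 4) * z ^ (((n : ℝ) - 2) / 4))) := by
    rintro E f hE ⟨h1, h2⟩
    have hq := sqrt_mul_div_sqrt_bessel_argument hn0 hlam hz0 E
    rw [← hS] at hq
    set X := E / (lam ^ ((1 : ℝ) / 4) * z ^ (((n : ℝ) - 2) / 4)) with hX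
    have hXpos : 0 < X := by positivity
    have l1 := mul_le_mul_of_nonneg_left h1 (Real.sqrt_nonneg z)
    have l2 := mul_le_mul_of_nonneg_left h2 (Real.sqrt_nonneg z)
    rw [mul_left_comm, hq] at l1 l2
    have c1 : (1 + S * b + (S * a)⁻¹)⁻¹ < S * a := by
      apply inv_lt_of_inv_lt₀ (by positivity)
      linarith [mul_pos hSpos hb]
    have c2 : S * b < 1 + S * b + (S * a)⁻¹ := by
      linarith [inv_pos.mpr (mul_pos hSpos ha)]
    constructor
    · calc _ < S * a * X := by gcongr
        _ = a * (S * X) := by ring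
        _ ≤ _ := l1
    · calc _ ≤ b * (S * X) := l2
        _ = S * b * X := by ring
        _ < _ := by gcongr
  obtain ⟨hK, hI⟩ := hab _ hy.le
  rw [neg_mul, neg_mul, harg]
  exact ⟨key _ _ (exp_pos _) hK, key _ _ (exp_pos _) hI⟩
end
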